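/- arXiv:1803.06228 — 2 statements merged into one kernel-verified Lean document; each statement's English description precedes it below -/
import Mathlib

section
/- The three vector fields X+ = −i ∂/∂x − i[λ+'(x) + (Λ − λ+(x)) λ−'(x)/λ−(x)] ∂/∂Λ, X− = −i x² ∂/∂x − i[λ−(x) + x² λ+'(x) + x(Λ − λ+(x))(x λ−'(x)/λ−(x) − 2)] ∂/∂Λ, and H = −2x ∂/∂x − 2[x λ+'(x) + (Λ − λ+(x))(x λ−'(x)/λ−(x) − 1)] ∂/∂Λ satisfy the sl(2) commutation relations [X+, X−] = H and [H, X±] = ±2 X±, as first-order differential operators acting on smooth functions of (x, Λ). -/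
open Complex

/-- Partial derivative with respect to the first variable. -/
noncomputable def d1 (f : ℂ → ℂ → ℂ) (x Λ : ℂ) : ℂ := deriv (fun t => f t Λ) x

/-- Partial derivative with respect to the second variable. -/
noncomputable def d2 (f : ℂ → ℂ → ℂ) (x Λ : ℂ) : ℂ := deriv (fun t => f x t) Λ

/-- Action of the vector field `ξ ∂/∂x + φ ∂/∂Λ` on a function of `(x, Λ)`. -/
noncomputable def VF (ξ φ : ℂ → ℂ → ℂ) (f : ℂ → ℂ → ℂ) : ℂ → ℂ → ℂ :=
  fun x Λ => ξ x Λ * d1 f x Λ + φ x Λ * d2 f x Λ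

theorem d1_eq_fderiv {f : ℂ → ℂ → ℂ} {x Λ : ℂ}
    (hf : DifferentiableAt ℂ (fun p : ℂ × ℂ => f p.1 p.2) (x, Λ)) :
    d1 f x Λ = fderiv ℂ (fun p : ℂ × ℂ => f p.1 p.2) (x, Λ) (1, 0) :=
  (hf.hasFDerivAt.comp_hasDerivAt (f := fun t => (t, Λ)) x
    ((hasDerivAt_id x).prodMk (hasDerivAt_const x Λ))).deriv

theorem d2_eq_fderiv {f : ℂ → ℂ → ℂ} {x Λ : ℂ}
    (hf : DifferentiableAt ℂ (fun p : ℂ × ℂ => f p.1 p.2) (x, Λ)) :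
    d2 f x Λ = fderiv ℂ (fun p : ℂ × ℂ => f p.1 p.2) (x, Λ) (0, 1) :=
  (hf.hasFDerivAt.comp_hasDerivAt (f := fun t => (x, t)) Λ
    ((hasDerivAt_const Λ x).prodMk (hasDerivAt_id Λ))).deriv

theorem contDiff_d1 {f : ℂ → ℂ → ℂ} (hf : ContDiff ℂ ⊤ (fun p : ℂ × ℂ => f p.1 p.2)) :
    ContDiff ℂ ⊤ (fun p : ℂ × ℂ => d1 f p.1 p.2) := by
  have h : (fun p : ℂ × ℂ => d1 f p.1 p.2) =
      fun p => fderiv ℂ (fun p : ℂ × ℂ => f p.1 p.2) p (1, 0) :=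
    funext fun p => d1_eq_fderiv (hf.differentiable (by simp) _)
  rw [h]
  exact (hf.fderiv_right (m := ⊤) le_top).clm_apply contDiff_const

theorem contDiff_d2 {f : ℂ → ℂ → ℂ} (hf : ContDiff ℂ ⊤ (fun p : ℂ × ℂ => f p.1 p.2)) :
    ContDiff ℂ ⊤ (fun p : ℂ × ℂ => d2 f p.1 p.2) := by
  have h : (fun p : ℂ × ℂ => d2 f p.1 p.2) =
      fun p => fderiv ℂ (fun p : ℂ × ℂ => f p.1 p.2) p (0, 1) :=
    funext fun p => d2_eq_fderiv (hf.differentiable (by simp) _)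
  rw [h]
  exact (hf.fderiv_right (m := ⊤) le_top).clm_apply contDiff_const

theorem d1_d2_comm {f : ℂ → ℂ → ℂ} (hf : ContDiff ℂ ⊤ (fun p : ℂ × ℂ => f p.1 p.2))
    (x Λ : ℂ) : d1 (d2 f) x Λ = d2 (d1 f) x Λ := by
  have hd := ((hf.fderiv_right (m := ⊤) le_top).differentiable (by simp)) (x, Λ)
  have h1 : (fun p : ℂ × ℂ => d1 f p.1 p.2) =
      fun p => fderiv ℂ (fun p : ℂ × ℂ => f p.1 p.2) p (1, 0) :=
    funext fun p => d1_eq_fderiv (hf.differentiable (by simp) _)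
  have h2 : (fun p : ℂ × ℂ => d2 f p.1 p.2) =
      fun p => fderiv ℂ (fun p : ℂ × ℂ => f p.1 p.2) p (0, 1) :=
    funext fun p => d2_eq_fderiv (hf.differentiable (by simp) _)
  rw [d1_eq_fderiv ((contDiff_d2 hf).differentiable (by simp) _),
    d2_eq_fderiv ((contDiff_d1 hf).differentiable (by simp) _), h1, h2,
    fderiv_clm_apply hd (by fun_prop), fderiv_clm_apply hd (by fun_prop)]
  simpa using (hf.contDiffAt.isSymmSndFDerivAt le_top) (1, 0) (0, 1)

theorem differentiableAt_fst_slice {f : ℂ → ℂ → ℂ}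
    (hf : Differentiable ℂ (fun p : ℂ × ℂ => f p.1 p.2)) (x Λ : ℂ) :
    DifferentiableAt ℂ (fun t => f t Λ) x :=
  (hf.comp (differentiable_id.prodMk (differentiable_const Λ))) x

theorem differentiableAt_snd_slice {f : ℂ → ℂ → ℂ}
    (hf : Differentiable ℂ (fun p : ℂ × ℂ => f p.1 p.2)) (x Λ : ℂ) :
    DifferentiableAt ℂ (fun t => f x t) Λ :=
  (hf.comp ((differentiable_const x).prodMk differentiable_id)) Λ

section VectorField

variable {ξ φ ξ' φ' f : ℂ → ℂ → ℂ}

theorem d1_VF (hξ : Differentiable ℂ (fun p : ℂ × ℂ => ξ p.1 p.2))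
    (hφ : Differentiable ℂ (fun p : ℂ × ℂ => φ p.1 p.2))
    (hf : ContDiff ℂ ⊤ (fun p : ℂ × ℂ => f p.1 p.2)) (x Λ : ℂ) :
    d1 (VF ξ φ f) x Λ = d1 ξ x Λ * d1 f x Λ + ξ x Λ * d1 (d1 f) x Λ +
      (d1 φ x Λ * d2 f x Λ + φ x Λ * d1 (d2 f) x Λ) :=
  (((differentiableAt_fst_slice hξ x Λ).hasDerivAt.mul (differentiableAt_fst_slice
    ((contDiff_d1 hf).differentiable (by simp)) x Λ).hasDerivAt).add
    ((differentiableAt_fst_slice hφ x Λ).hasDerivAt.mul (differentiableAt_fst_slice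
    ((contDiff_d2 hf).differentiable (by simp)) x Λ).hasDerivAt)).deriv

theorem d2_VF (hξ : Differentiable ℂ (fun p : ℂ × ℂ => ξ p.1 p.2))
    (hφ : Differentiable ℂ (fun p : ℂ × ℂ => φ p.1 p.2))
    (hf : ContDiff ℂ ⊤ (fun p : ℂ × ℂ => f p.1 p.2)) (x Λ : ℂ) :
    d2 (VF ξ φ f) x Λ = d2 ξ x Λ * d1 f x Λ + ξ x Λ * d2 (d1 f) x Λ +
      (d2 φ x Λ * d2 f x Λ + φ x Λ * d2 (d2 f) x Λ) :=
  (((differentiableAt_snd_slice hξ x Λ).hasDerivAt.mul (differentiableAt_snd_slice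
    ((contDiff_d1 hf).differentiable (by simp)) x Λ).hasDerivAt).add
    ((differentiableAt_snd_slice hφ x Λ).hasDerivAt.mul (differentiableAt_snd_slice
    ((contDiff_d2 hf).differentiable (by simp)) x Λ).hasDerivAt)).deriv

/-- The commutator of two vector fields is the vector field whose coefficients are obtained by
letting each field act on the coefficients of the other. -/
theorem VF_commutator (hξ : Differentiable ℂ (fun p : ℂ × ℂ => ξ p.1 p.2))
    (hφ : Differentiable ℂ (fun p : ℂ × ℂ => φ p.1 p.2))
    (hξ' : Differentiable ℂ (fun p : ℂ × ℂ => ξ' p.1 p.2))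
    (hφ' : Differentiable ℂ (fun p : ℂ × ℂ => φ' p.1 p.2))
    (hf : ContDiff ℂ ⊤ (fun p : ℂ × ℂ => f p.1 p.2)) (x Λ : ℂ) :
    VF ξ φ (VF ξ' φ' f) x Λ - VF ξ' φ' (VF ξ φ f) x Λ =
      (VF ξ φ ξ' x Λ - VF ξ' φ' ξ x Λ) * d1 f x Λ +
      (VF ξ φ φ' x Λ - VF ξ' φ' φ x Λ) * d2 f x Λ := by
  have e (α β g : ℂ → ℂ → ℂ) : VF α β g x Λ = α x Λ * d1 g x Λ + β x Λ * d2 g x Λ := rfl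
  rw [e ξ φ (VF ξ' φ' f), e ξ' φ' (VF ξ φ f), d1_VF hξ hφ hf, d2_VF hξ hφ hf,
    d1_VF hξ' hφ' hf, d2_VF hξ' hφ' hf, d1_d2_comm hf, e, e, e, e]
  ring

end VectorField

theorem stmt4 (lp lm : ℂ → ℂ)
    (hlp : ContDiff ℂ ⊤ lp) (hlm : ContDiff ℂ ⊤ lm)
    (hne : ∀ x : ℂ, lm x ≠ 0)
    -- the three vector fields
    (ξp ξm ξh φp φm φh : ℂ → ℂ → ℂ)
    (hξp : ξp = fun _ _ => -Complex.I)
    (hφp : φp = fun x Λ => -Complex.I *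
      (deriv lp x + (Λ - lp x) * deriv lm x / lm x))
    (hξm : ξm = fun x _ => -Complex.I * x ^ 2)
    (hφm : φm = fun x Λ => -Complex.I *
      (lm x + x ^ 2 * deriv lp x + x * (Λ - lp x) * (x * deriv lm x / lm x - 2)))
    (hξh : ξh = fun x _ => -2 * x)
    (hφh : φh = fun x Λ => -2 *
      (x * deriv lp x + (Λ - lp x) * (x * deriv lm x / lm x - 1))) :
    ∀ f : ℂ → ℂ → ℂ, ContDiff ℂ ⊤ (fun p : ℂ × ℂ => f p.1 p.2) →
      ∀ x Λ : ℂ,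
        (VF ξp φp (VF ξm φm f) x Λ - VF ξm φm (VF ξp φp f) x Λ = VF ξh φh f x Λ) ∧
        (VF ξh φh (VF ξp φp f) x Λ - VF ξp φp (VF ξh φh f) x Λ = 2 * VF ξp φp f x Λ) ∧
        (VF ξh φh (VF ξm φm f) x Λ - VF ξm φm (VF ξh φh f) x Λ = -2 * VF ξm φm f x Λ) := by
  intro f hf x Λ
  have hp : Differentiable ℂ lp := hlp.differentiable (by simp)
  have hm : Differentiable ℂ lm := hlm.differentiable (by simp)
  have hp' : Differentiable ℂ (deriv lp) :=
    ((contDiff_succ_iff_deriv (n := ⊤)).1 hlp).2.2.differentiable (by simp)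
  have hm' : Differentiable ℂ (deriv lm) :=
    ((contDiff_succ_iff_deriv (n := ⊤)).1 hlm).2.2.differentiable (by simp)
  obtain ⟨w, hw, hinv⟩ : ∃ w : ℂ → ℂ, Differentiable ℂ w ∧ ∀ t, (lm t)⁻¹ = w t :=
    ⟨_, hm.inv hne, fun _ => rfl⟩
  have dξp : Differentiable ℂ (fun p : ℂ × ℂ => ξp p.1 p.2) := by
    subst hξp; fun_prop
  have dξm : Differentiable ℂ (fun p : ℂ × ℂ => ξm p.1 p.2) := by
    subst hξm; fun_prop
  have dξh : Differentiable ℂ (fun p : ℂ × ℂ => ξh p.1 p.2) := by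
    subst hξh; fun_prop
  have dφp : Differentiable ℂ (fun p : ℂ × ℂ => φp p.1 p.2) := by
    subst hφp; simp only [div_eq_mul_inv, hinv]; fun_prop
  have dφm : Differentiable ℂ (fun p : ℂ × ℂ => φm p.1 p.2) := by
    subst hφm; simp only [div_eq_mul_inv, hinv]; fun_prop
  have dφh : Differentiable ℂ (fun p : ℂ × ℂ => φh p.1 p.2) := by
    subst hφh; simp only [div_eq_mul_inv, hinv]; fun_prop
  rw [VF_commutator dξp dφp dξm dφm hf, VF_commutator dξh dφh dξp dφp hf,
    VF_commutator dξh dφh dξm dφm hf]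
  have kp := (hp x).hasDerivAt
  have km := (hm x).hasDerivAt
  have kp' := (hp' x).hasDerivAt
  have km' := (hm' x).hasDerivAt
  have kid := hasDerivAt_id' x
  have kid2 := hasDerivAt_pow 2 x
  have kΛ := hasDerivAt_id' Λ
  have ku := kp.const_sub Λ
  have kv := kΛ.sub_const (lp x)
  have kq := (kid.mul km').div km (hne x)
  have ξp1 : d1 ξp x Λ = 0 := by subst hξp; exact deriv_const _ _
  have ξp2 : d2 ξp x Λ = 0 := by subst hξp; exact deriv_const _ _
  have ξm1 : d1 ξm x Λ = _ := (congrArg (d1 · x Λ) hξm).trans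
    (kid2.const_mul _).deriv
  have ξm2 : d2 ξm x Λ = 0 := by subst hξm; exact deriv_const _ _
  have ξh1 : d1 ξh x Λ = _ := (congrArg (d1 · x Λ) hξh).trans
    (kid.const_mul _).deriv
  have ξh2 : d2 ξh x Λ = 0 := by subst hξh; exact deriv_const _ _
  have φp1 : d1 φp x Λ = _ := (congrArg (d1 · x Λ) hφp).trans
    ((kp'.add ((ku.mul km').div km (hne x))).const_mul _).deriv
  have φp2 : d2 φp x Λ = _ := (congrArg (d2 · x Λ) hφp).trans
    ((((kv.mul_const (deriv lm x)).div_const (lm x)).const_add _).const_mul _).deriv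
  have φm1 : d1 φm x Λ = _ := (congrArg (d1 · x Λ) hφm).trans
    (((km.add (kid2.mul kp')).add ((kid.mul ku).mul (kq.sub_const 2))).const_mul _).deriv
  have φm2 : d2 φm x Λ = _ := (congrArg (d2 · x Λ) hφm).trans
    ((((kv.const_mul x).mul_const _).const_add _).const_mul _).deriv
  have φh1 : d1 φh x Λ = _ := (congrArg (d1 · x Λ) hφh).trans
    (((kid.mul kp').add (ku.mul (kq.sub_const 1))).const_mul _).deriv
  have φh2 : d2 φh x Λ = _ := (congrArg (d2 · x Λ) hφh).trans
    (((kv.mul_const _).const_add _).const_mul _).deriv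
  have hx := hne x
  simp only [VF, ξp1, ξp2, ξm1, ξm2, ξh1, ξh2, φp1, φp2, φm1, φm2, φh1, φh2]
  simp only [hξp, hξm, hξh, hφp, hφm, hφh, Pi.mul_apply, Pi.div_apply]
  refine ⟨?_, ?_, ?_⟩ <;> field_simp
  · ring_nf
    simp only [Complex.I_sq]
    ring
  · ring
  · ring
end

section
/- The third determining equation, after substituting g1(x) = f0(Ω2Ω̄' − Ω2'Ω̄)/(Ω2Ω̄) − f0' and the corresponding closed-form expression for g0 in terms of f0, f0', f0'' obtained from the second determining equation, becomes a third-order linear homogeneous ODE for f0 alone: Υ0(x) f0(x) + Υ1(x) f0'(x) − [Ω2(x)Ω̄(x)]³ f0'''(x) = 0, for some functions Υ0, Υ1 built polynomially from Ω0, Ω1, Ω2, Ω̄ and their derivatives up to third order. In particular, since this is a linear third-order ODE with coefficient [Ω2Ω̄]³ ≠ 0 of the highest derivative, its solution space is a 3-dimensional vector space over ℂ. -/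
/-- `g₁` expressed in terms of `f₀` from the first determining equation. -/
noncomputable def g1fun (Ωb Ω2 f0 : ℝ → ℂ) : ℝ → ℂ := fun x =>
  f0 x * (Ω2 x * deriv Ωb x - deriv Ω2 x * Ωb x) / (Ω2 x * Ωb x) - deriv f0 x

/-- `g₀` expressed in terms of `f₀, f₀', f₀''` from the second determining equation. -/
noncomputable def g0fun (Ωb Ω1 Ω2 f0 : ℝ → ℂ) : ℝ → ℂ := fun x =>
  f0 x / (2 * Ω2 x * Ωb x) *
      (Ωb x * (deriv Ω1 x + deriv (deriv Ωb) x)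
        - deriv Ωb x * (Ω1 x + deriv Ωb x)
        + (Ωb x / Ω2 x) ^ 2 * ((deriv Ω2 x) ^ 2 - Ω2 x * deriv (deriv Ω2) x))
    + deriv f0 x / (2 * (Ω2 x) ^ 2) *
        (Ω2 x * (Ω1 x + deriv Ωb x) - Ωb x * deriv Ω2 x)
    - deriv (deriv f0) x * Ωb x / (2 * Ω2 x)

/-- The third determining equation, with `g₀, g₁` substituted. -/
noncomputable def thirdDetEq (Ωb Ω0 Ω1 Ω2 f0 : ℝ → ℂ) (x : ℝ) : Prop :=
  (deriv f0 x - g1fun Ωb Ω2 f0 x) * Ω0 x * Ωb x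
    - (g0fun Ωb Ω1 Ω2 f0 x * Ω1 x + deriv (g0fun Ωb Ω1 Ω2 f0) x * Ωb x) * Ωb x
    + f0 x * (deriv Ω0 x * Ωb x - Ω0 x * deriv Ωb x) = 0

open Set Metric

/-- Two solutions of a linear ODE on a symmetric interval that agree at `0` coincide. -/
theorem linearODE_eqOn_Ioo {E : Type*} [NormedAddCommGroup E] [NormedSpace ℝ E]
    {A : ℝ → E →L[ℝ] E} (hA : Continuous A) {T : ℝ} (hT : 0 < T) {x y : ℝ → E}
    (hx : ∀ t ∈ Ioo (-T) T, HasDerivAt x (A t (x t)) t)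
    (hy : ∀ t ∈ Ioo (-T) T, HasDerivAt y (A t (y t)) t) (h0 : x 0 = y 0) :
    EqOn x y (Ioo (-T) T) := by
  obtain ⟨K, hK⟩ := (isCompact_Icc (a := -T) (b := T)).exists_bound_of_continuousOn hA.continuousOn
  refine ODE_solution_unique_of_mem_Ioo (v := fun t z => A t z) (s := fun _ => univ)
    (K := K.toNNReal) (fun t ht => ?_) (t₀ := 0) ⟨by linarith, hT⟩
    (fun t ht => ⟨hx t ht, mem_univ _⟩) (fun t ht => ⟨hy t ht, mem_univ _⟩) h0
  refine ((A t).lipschitz.weaken ?_).lipschitzOnWith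
  rw [← NNReal.coe_le_coe]
  exact (hK t (Ioo_subset_Icc_self ht)).trans (Real.le_coe_toNNReal K)

/-- A solution of `x' = f t x` with `‖f t x‖ ≤ K ‖x‖` on `[-T, T]` grows at most exponentially. -/
theorem norm_le_exp_of_norm_deriv_le {E : Type*} [NormedAddCommGroup E] [NormedSpace ℝ E]
    {T K : ℝ} (hK : 0 ≤ K) {x x' : ℝ → E}
    (hx : ∀ t ∈ Icc (-T) T, HasDerivWithinAt x (x' t) (Icc (-T) T) t)
    (hb : ∀ t ∈ Icc (-T) T, ‖x' t‖ ≤ K * ‖x t‖) :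
    ∀ t ∈ Icc (-T) T, ‖x t‖ ≤ ‖x 0‖ * Real.exp (K * T) := by
  have forward : ∀ {u u' : ℝ → E},
      (∀ t ∈ Icc (-T) T, HasDerivWithinAt u (u' t) (Icc (-T) T) t) →
      (∀ t ∈ Icc (-T) T, ‖u' t‖ ≤ K * ‖u t‖) →
      ∀ t ∈ Icc 0 T, ‖u t‖ ≤ ‖u 0‖ * Real.exp (K * T) := by
    intro u u' hu hub t ht
    have hsub : Icc 0 T ⊆ Icc (-T) T := fun s hs => ⟨by linarith [hs.1, hs.2], hs.2⟩
    have hg := norm_le_gronwallBound_of_norm_deriv_right_le (f := u) (f' := u') (δ := ‖u 0‖)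
      (K := K) (ε := 0) (a := 0) (b := T)
      (fun s hs => ((hu s (hsub hs)).continuousWithinAt).mono hsub)
      (fun s hs => (hu s (hsub (Ico_subset_Icc_self hs))).mono_of_mem_nhdsWithin
        (Filter.mem_of_superset (Icc_mem_nhdsGE hs.2)
          (fun r hr => ⟨by linarith [hs.1, hs.2, hr.1], hr.2⟩)))
      le_rfl (fun s hs => by simpa using hub s (hsub (Ico_subset_Icc_self hs))) t ht
    rw [gronwallBound_ε0, sub_zero] at hg
    refine hg.trans ?_
    gcongr
    exact ht.2
  intro t ht
  rcases le_total 0 t with h | h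
  · exact forward hx hb t ⟨h, ht.2⟩
  · have hneg : ∀ s ∈ Icc (-T) T, -s ∈ Icc (-T) T := fun s hs =>
      ⟨by linarith [hs.2], by linarith [hs.1]⟩
    have := forward (u := fun s => x (-s)) (u' := fun s => -x' (-s))
      (fun s hs => by
        simpa [Function.comp_def] using (hx (-s) (hneg s hs)).scomp s ((hasDerivWithinAt_neg s (Icc (-T) T))) hneg)
      (fun s hs => by simpa using hb (-s) (hneg s hs)) (-t) ⟨by linarith, by linarith [ht.1]⟩
    simpa using this

/-- A linear ODE with continuous coefficients is solvable on every bounded interval. -/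
theorem exists_linearODE_solution_Ioo {E : Type*} [NormedAddCommGroup E] [NormedSpace ℝ E]
    [FiniteDimensional ℝ E] {A : ℝ → E →L[ℝ] E} (hA : Continuous A) {T : ℝ} (hT : 0 < T) (x₀ : E) :
    ∃ x : ℝ → E, x 0 = x₀ ∧ ∀ t ∈ Ioo (-T) T, HasDerivAt x (A t (x t)) t := by
  have : CompleteSpace E := FiniteDimensional.complete ℝ E
  obtain ⟨K, hK⟩ := (isCompact_Icc (a := -T) (b := T)).exists_bound_of_continuousOn hA.continuousOn
  have hK0 : 0 ≤ K := (norm_nonneg _).trans (hK 0 ⟨by linarith, hT.le⟩)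
  set R : ℝ := ‖x₀‖ * Real.exp (K * T) + 1 with hR
  have hRpos : 0 < R := by positivity
  let φ : ContDiffBump (0 : E) := ⟨R, R + 1, hRpos, by linarith⟩
  let ψ : E → E := fun x => φ x • x
  have hψd : ContDiff ℝ 1 ψ := φ.contDiff.smul contDiff_id
  have hψc : HasCompactSupport ψ := φ.hasCompactSupport.smul_right
  obtain ⟨C, hC⟩ := hψd.lipschitzWith_of_hasCompactSupport (𝕂 := ℝ) hψc one_ne_zero
  obtain ⟨M, hM⟩ := hψc.exists_bound_of_continuous hψd.continuous
  have hM0 : 0 ≤ M := (norm_nonneg _).trans (hM 0)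
  have hψn : ∀ x, ‖ψ x‖ ≤ ‖x‖ := fun x => by
    simp only [ψ, norm_smul, Real.norm_eq_abs, abs_of_nonneg φ.nonneg]
    exact mul_le_of_le_one_left (norm_nonneg _) φ.le_one
  have hψe : ∀ x, ‖x‖ ≤ R → ψ x = x := fun x hx => by
    have : φ x = 1 := φ.one_of_mem_closedBall (by simpa using hx)
    simp [ψ, this]
  have hPL : IsPicardLindelof (fun t x => A t (ψ x)) (tmin := -T) (tmax := T)
      ⟨0, by linarith, hT.le⟩ x₀ (K * M * T).toNNReal 0 (K * M).toNNReal
      (K.toNNReal * C) := by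
    refine ⟨fun t ht => ?_, fun x _ => ?_, fun t ht x _ => ?_, ?_⟩
    · have hl : LipschitzWith K.toNNReal (A t) := (A t).lipschitz.weaken (by
        rw [← NNReal.coe_le_coe]
        exact (hK t ht).trans (Real.le_coe_toNNReal K))
      exact (hl.comp hC).lipschitzOnWith
    · exact (hA.clm_apply continuous_const).continuousOn
    · rw [Real.coe_toNNReal _ (by positivity)]
      exact (A t).le_of_opNorm_le_of_le (hK t ht) (hM x)
    · rw [Real.coe_toNNReal _ (by positivity), Real.coe_toNNReal _ (by positivity)]
      simp
  obtain ⟨x, hx0, hx⟩ := hPL.exists_eq_forall_mem_Icc_hasDerivWithinAt₀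
  replace hx0 : x 0 = x₀ := hx0
  have hbound := norm_le_exp_of_norm_deriv_le hK0 hx
    (fun t ht => (A t).le_of_opNorm_le_of_le (hK t ht) (hψn _))
  refine ⟨x, hx0, fun t ht => ?_⟩
  have ht' := Ioo_subset_Icc_self ht
  have := (hx t ht').hasDerivAt (Icc_mem_nhds ht.1 ht.2)
  rwa [hψe _ ((hbound t ht').trans (by rw [hx0, hR]; linarith))] at this

/-- A linear ODE with continuous coefficients has a global solution for every initial value. -/
theorem exists_linearODE_solution {E : Type*} [NormedAddCommGroup E] [NormedSpace ℝ E]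
    [FiniteDimensional ℝ E] {A : ℝ → E →L[ℝ] E} (hA : Continuous A) (x₀ : E) :
    ∃ x : ℝ → E, x 0 = x₀ ∧ ∀ t, HasDerivAt x (A t (x t)) t := by
  choose α hα0 hα using fun n : ℕ =>
    exists_linearODE_solution_Ioo hA (T := (n : ℝ) + 1) (by positivity) x₀
  have agree : ∀ m n : ℕ, m ≤ n → EqOn (α m) (α n) (Ioo (-((m : ℝ) + 1)) (m + 1)) := by
    intro m n hmn
    have hmn' : (m : ℝ) ≤ n := by exact_mod_cast hmn
    exact linearODE_eqOn_Ioo hA (by positivity) (hα m)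
      (fun t ht => hα n t ⟨by linarith [ht.1], by linarith [ht.2]⟩) (by rw [hα0, hα0])
  have mem : ∀ (n : ℕ) (t : ℝ), |t| ≤ n → t ∈ Ioo (-((n : ℝ) + 1)) (n + 1) := fun n t h =>
    ⟨by linarith [neg_abs_le t], by linarith [le_abs_self t]⟩
  have key : ∀ (n : ℕ) (t : ℝ), |t| ≤ n → α ⌈|t|⌉₊ t = α n t := fun n t h =>
    agree _ _ (Nat.ceil_le.2 h) (mem _ t (Nat.le_ceil _))
  refine ⟨fun t => α ⌈|t|⌉₊ t, by simpa using hα0 _, fun t => ?_⟩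
  obtain ⟨n, hn⟩ := exists_nat_gt |t|
  have hev : (fun t => α ⌈|t|⌉₊ t) =ᶠ[nhds t] α n := by
    filter_upwards [continuous_abs.continuousAt.eventually_lt continuousAt_const hn] with s hs
    exact key n s (le_of_lt hs)
  have := (hα n t (mem n t hn.le)).congr_of_eventuallyEq hev
  simpa only [key n t hn.le] using this

/-- The companion matrix of `y⁽³⁾ = p y + q y⁽¹⁾`. -/
noncomputable def companion (p q : ℂ) : (ℂ × ℂ × ℂ) →L[ℝ] (ℂ × ℂ × ℂ) :=
  let π₁ : (ℂ × ℂ × ℂ) →L[ℝ] ℂ := ContinuousLinearMap.fst ℝ ℂ (ℂ × ℂ)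
  let π₂₃ : (ℂ × ℂ × ℂ) →L[ℝ] ℂ × ℂ := ContinuousLinearMap.snd ℝ ℂ (ℂ × ℂ)
  let π₂ : (ℂ × ℂ × ℂ) →L[ℝ] ℂ := (ContinuousLinearMap.fst ℝ ℂ ℂ).comp π₂₃
  let π₃ : (ℂ × ℂ × ℂ) →L[ℝ] ℂ := (ContinuousLinearMap.snd ℝ ℂ ℂ).comp π₂₃
  π₂.prod (π₃.prod 0) + p • ((0 : (ℂ × ℂ × ℂ) →L[ℝ] ℂ).prod ((0 : (ℂ × ℂ × ℂ) →L[ℝ] ℂ).prod π₁))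
    + q • ((0 : (ℂ × ℂ × ℂ) →L[ℝ] ℂ).prod ((0 : (ℂ × ℂ × ℂ) →L[ℝ] ℂ).prod π₂))

@[simp] theorem companion_apply (p q : ℂ) (v : ℂ × ℂ × ℂ) :
    companion p q v = (v.2.1, v.2.2, p * v.1 + q * v.2.1) := by
  simp [companion]

theorem continuous_companion {p q : ℝ → ℂ} (hp : Continuous p) (hq : Continuous q) :
    Continuous fun t => companion (p t) (q t) := by
  unfold companion
  fun_prop

theorem iteratedDeriv_three {f : ℝ → ℂ} : iteratedDeriv 3 f = deriv (deriv (deriv f)) := by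
  simp [iteratedDeriv_succ, iteratedDeriv_zero]

/-- A `C³` solution of `y⁽³⁾ = p y + q y⁽¹⁾` gives a solution of the companion system. -/
theorem hasDerivAt_jet {p q y : ℝ → ℂ} (hy : ContDiff ℝ 3 y)
    (h : ∀ t, deriv (deriv (deriv y)) t = p t * y t + q t * deriv y t) (t : ℝ) :
    HasDerivAt (fun s => (y s, deriv y s, deriv (deriv y) s))
      (companion (p t) (q t) (y t, deriv y t, deriv (deriv y) t)) t := by
  have h1 : ContDiff ℝ 2 (deriv y) := ContDiff.deriv' (n := 2) hy
  have h2 : ContDiff ℝ 1 (deriv (deriv y)) := ContDiff.deriv' (n := 1) h1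
  rw [companion_apply]
  refine (hy.differentiable (by norm_num) t).hasDerivAt.prodMk
    ((h1.differentiable (by norm_num) t).hasDerivAt.prodMk ?_)
  have := (h2.differentiable (by norm_num) t).hasDerivAt
  rwa [h t] at this

/-- `y⁽³⁾ = p y + q y⁽¹⁾` has a `C³` solution with any prescribed initial `2`-jet at `0`. -/
theorem exists_third_order_solution {p q : ℝ → ℂ} (hp : Continuous p) (hq : Continuous q)
    (v : ℂ × ℂ × ℂ) :
    ∃ y : ℝ → ℂ, ContDiff ℝ 3 y ∧
      (∀ t, deriv (deriv (deriv y)) t = p t * y t + q t * deriv y t) ∧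
      (y 0, deriv y 0, deriv (deriv y) 0) = v := by
  obtain ⟨x, hx0, hx⟩ := exists_linearODE_solution (continuous_companion hp hq) v
  have hx1 : ∀ t, HasDerivAt (fun s => (x s).1) (x t).2.1 t := fun t => by
    simpa [Function.comp_def] using (ContinuousLinearMap.fst ℝ ℂ (ℂ × ℂ)).hasFDerivAt.comp_hasDerivAt t (hx t)
  have hx23 : ∀ t, HasDerivAt (fun s => (x s).2) ((x t).2.2, p t * (x t).1 + q t * (x t).2.1) t :=
    fun t => by
      simpa [Function.comp_def] using (ContinuousLinearMap.snd ℝ ℂ (ℂ × ℂ)).hasFDerivAt.comp_hasDerivAt t (hx t)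
  have hx2 : ∀ t, HasDerivAt (fun s => (x s).2.1) (x t).2.2 t := fun t => by
    simpa [Function.comp_def] using (ContinuousLinearMap.fst ℝ ℂ ℂ).hasFDerivAt.comp_hasDerivAt t (hx23 t)
  have hx3 : ∀ t, HasDerivAt (fun s => (x s).2.2) (p t * (x t).1 + q t * (x t).2.1) t :=
    fun t => by
      simpa [Function.comp_def] using (ContinuousLinearMap.snd ℝ ℂ ℂ).hasFDerivAt.comp_hasDerivAt t (hx23 t)
  have d1 : deriv (fun s => (x s).1) = fun s => (x s).2.1 := funext fun t => (hx1 t).deriv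
  have d2 : deriv (fun s => (x s).2.1) = fun s => (x s).2.2 := funext fun t => (hx2 t).deriv
  have d3 : deriv (fun s => (x s).2.2) = fun t => p t * (x t).1 + q t * (x t).2.1 :=
    funext fun t => (hx3 t).deriv
  have hxc : Continuous x := continuous_iff_continuousAt.2 fun t => (hx t).continuousAt
  have c3 : ContDiff ℝ 1 (fun s => (x s).2.2) :=
    contDiff_one_iff_deriv.2 ⟨fun t => (hx3 t).differentiableAt, by rw [d3]; fun_prop⟩
  have c2 : ContDiff ℝ (1 + 1) (fun s => (x s).2.1) :=
    contDiff_succ_iff_deriv.2 ⟨fun t => (hx2 t).differentiableAt, by simp, by rwa [d2]⟩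
  have c1 : ContDiff ℝ (1 + 1 + 1) (fun s => (x s).1) :=
    contDiff_succ_iff_deriv.2 ⟨fun t => (hx1 t).differentiableAt,
      fun h => absurd h (by decide), by rwa [d1]⟩
  refine ⟨fun s => (x s).1, ?_, fun t => ?_, ?_⟩
  · convert c1 using 1
    norm_num
  · rw [d1, d2, d3]
  · rw [d1, d2, ← hx0]

/-- `C³` solutions of `y⁽³⁾ = p y + q y⁽¹⁾` are determined by their `2`-jet at `0`. -/
theorem third_order_solution_unique {p q : ℝ → ℂ} (hp : Continuous p) (hq : Continuous q)
    {y z : ℝ → ℂ} (hy : ContDiff ℝ 3 y) (hz : ContDiff ℝ 3 z)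
    (hy' : ∀ t, deriv (deriv (deriv y)) t = p t * y t + q t * deriv y t)
    (hz' : ∀ t, deriv (deriv (deriv z)) t = p t * z t + q t * deriv z t)
    (h0 : (y 0, deriv y 0, deriv (deriv y) 0) = (z 0, deriv z 0, deriv (deriv z) 0)) :
    y = z := by
  funext t
  have := linearODE_eqOn_Ioo (continuous_companion hp hq) (T := |t| + 1) (by positivity)
    (fun s _ => hasDerivAt_jet hy hy' s) (fun s _ => hasDerivAt_jet hz hz' s) h0
    (show t ∈ Ioo _ _ from ⟨by linarith [neg_abs_le t], by linarith [le_abs_self t]⟩)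
  exact congrArg Prod.fst this

/-- The `C³` solutions of `y⁽³⁾ = p y + q y⁽¹⁾` form a three-dimensional space. -/
theorem exists_third_order_fundamental_system {p q : ℝ → ℂ} (hp : Continuous p)
    (hq : Continuous q) :
    ∃ y : Fin 3 → ℝ → ℂ,
      (∀ i, ContDiff ℝ 3 (y i) ∧
        ∀ t, deriv (deriv (deriv (y i))) t = p t * y i t + q t * deriv (y i) t) ∧
      LinearIndependent ℂ y ∧
      ∀ z : ℝ → ℂ, ContDiff ℝ 3 z →
        (∀ t, deriv (deriv (deriv z)) t = p t * z t + q t * deriv z t) →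
        ∃ c : Fin 3 → ℂ, ∀ t, z t = ∑ i, c i * y i t := by
  obtain ⟨y₀, c₀, e₀, i₀⟩ := exists_third_order_solution hp hq (1, 0, 0)
  obtain ⟨y₁, c₁, e₁, i₁⟩ := exists_third_order_solution hp hq (0, 1, 0)
  obtain ⟨y₂, c₂, e₂, i₂⟩ := exists_third_order_solution hp hq (0, 0, 1)
  simp only [Prod.mk.injEq] at i₀ i₁ i₂
  have diff : ∀ {y : ℝ → ℂ}, ContDiff ℝ 3 y →
      Differentiable ℝ y ∧ Differentiable ℝ (deriv y) ∧ Differentiable ℝ (deriv (deriv y)) := by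
    intro y hy
    have h1 : ContDiff ℝ 2 (deriv y) := ContDiff.deriv' (n := 2) hy
    have h2 : ContDiff ℝ 1 (deriv (deriv y)) := ContDiff.deriv' (n := 1) h1
    exact ⟨hy.differentiable (by norm_num), h1.differentiable (by norm_num),
      h2.differentiable (by norm_num)⟩
  have dcomb : ∀ (a b c : ℂ) {u v w : ℝ → ℂ}, Differentiable ℝ u → Differentiable ℝ v →
      Differentiable ℝ w → deriv (fun t => a * u t + b * v t + c * w t) =
        fun t => a * deriv u t + b * deriv v t + c * deriv w t := by
    intro a b c u v w hu hv hw
    funext t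
    exact ((((hu t).hasDerivAt.const_mul a).add ((hv t).hasDerivAt.const_mul b)).add
      ((hw t).hasDerivAt.const_mul c)).deriv
  obtain ⟨d₀, d₀', d₀''⟩ := diff c₀
  obtain ⟨d₁, d₁', d₁''⟩ := diff c₁
  obtain ⟨d₂, d₂', d₂''⟩ := diff c₂
  refine ⟨![y₀, y₁, y₂], fun i => ?_, ?_, fun z hz hz' => ?_⟩
  · fin_cases i
    exacts [⟨c₀, e₀⟩, ⟨c₁, e₁⟩, ⟨c₂, e₂⟩]
  · rw [Fintype.linearIndependent_iff]
    intro g hg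
    have hfun : (fun t => g 0 * y₀ t + g 1 * y₁ t + g 2 * y₂ t) = fun _ => 0 := by
      funext t
      simpa [Fin.sum_univ_three] using congrFun hg t
    have hfun' := congrArg deriv hfun
    have hfun'' := congrArg deriv hfun'
    rw [dcomb _ _ _ d₀ d₁ d₂] at hfun' hfun''
    rw [dcomb _ _ _ d₀' d₁' d₂'] at hfun''
    have g0 := congrFun hfun 0
    have g1 := congrFun hfun' 0
    have g2 := congrFun hfun'' 0
    simp [i₀, i₁, i₂] at g0 g1 g2
    intro i
    fin_cases i
    exacts [g0, g1, g2]
  · refine ⟨![z 0, deriv z 0, deriv (deriv z) 0], fun t => ?_⟩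
    have := third_order_solution_unique hp hq hz
      (z := fun t => z 0 * y₀ t + deriv z 0 * y₁ t + deriv (deriv z) 0 * y₂ t)
      (((contDiff_const.mul c₀).add (contDiff_const.mul c₁)).add (contDiff_const.mul c₂)) hz'
      (fun t => by
        rw [dcomb _ _ _ d₀ d₁ d₂, dcomb _ _ _ d₀' d₁' d₂', dcomb _ _ _ d₀'' d₁'' d₂'']
        simp only [e₀, e₁, e₂]
        ring)
      (by
        rw [dcomb _ _ _ d₀ d₁ d₂, dcomb _ _ _ d₀' d₁' d₂']
        simp [i₀, i₁, i₂])
    simpa [Fin.sum_univ_three] using congrFun this t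

theorem stmt15 (Ωb Ω0 Ω1 Ω2 : ℝ → ℂ)
    (hΩb : ContDiff ℝ 3 Ωb) (hΩ0 : ContDiff ℝ 3 Ω0)
    (hΩ1 : ContDiff ℝ 3 Ω1) (hΩ2 : ContDiff ℝ 3 Ω2)
    (hnz : ∀ x, Ω2 x * Ωb x ≠ 0) :
    ∃ Υ0 Υ1 : ℝ → ℂ,
      -- the third determining equation becomes a third-order linear ODE in f₀
      (∀ f0 : ℝ → ℂ, ContDiff ℝ (⊤ : ℕ∞) f0 → ∀ x : ℝ,
        thirdDetEq Ωb Ω0 Ω1 Ω2 f0 x ↔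
          Υ0 x * f0 x + Υ1 x * deriv f0 x
            - (Ω2 x * Ωb x) ^ 3 * iteratedDeriv 3 f0 x = 0) ∧
      -- whose solution space is three-dimensional
      (∃ y : Fin 3 → ℝ → ℂ,
        (∀ i, ContDiff ℝ 3 (y i) ∧ ∀ x, Υ0 x * y i x + Υ1 x * deriv (y i) x
          - (Ω2 x * Ωb x) ^ 3 * iteratedDeriv 3 (y i) x = 0) ∧
        LinearIndependent ℂ y ∧
        ∀ z : ℝ → ℂ, ContDiff ℝ 3 z →
          (∀ x, Υ0 x * z x + Υ1 x * deriv z x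
            - (Ω2 x * Ωb x) ^ 3 * iteratedDeriv 3 z x = 0) →
          ∃ c : Fin 3 → ℂ, ∀ x, z x = ∑ i, c i * y i x) := by
  have hb0 : ∀ x, Ωb x ≠ 0 := fun x => right_ne_zero_of_mul (hnz x)
  have h20 : ∀ x, Ω2 x ≠ 0 := fun x => left_ne_zero_of_mul (hnz x)
  have hb1 : ContDiff ℝ 2 (deriv Ωb) := ContDiff.deriv' (n := 2) hΩb
  have hb2 : ContDiff ℝ 1 (deriv (deriv Ωb)) := ContDiff.deriv' (n := 1) hb1
  have h21 : ContDiff ℝ 2 (deriv Ω2) := ContDiff.deriv' (n := 2) hΩ2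
  have h22 : ContDiff ℝ 1 (deriv (deriv Ω2)) := ContDiff.deriv' (n := 1) h21
  have h11 : ContDiff ℝ 2 (deriv Ω1) := ContDiff.deriv' (n := 2) hΩ1
  have h01 : ContDiff ℝ 2 (deriv Ω0) := ContDiff.deriv' (n := 2) hΩ0
  have lower : ∀ {f : ℝ → ℂ} {n : WithTop ℕ∞}, ContDiff ℝ n f → 1 ≤ n → ContDiff ℝ 1 f :=
    fun h hn => h.of_le hn
  have kb := lower hΩb (by norm_num)
  have k1 := lower hΩ1 (by norm_num)
  have k2 := lower hΩ2 (by norm_num)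
  have kb' := lower hb1 (by norm_num)
  have k1' := lower h11 (by norm_num)
  have k2' := lower h21 (by norm_num)
  -- the coefficients of `f₀` and `f₀'` in `g₀`
  let a : ℝ → ℂ := fun x => 1 / (2 * Ω2 x * Ωb x) *
      (Ωb x * (deriv Ω1 x + deriv (deriv Ωb) x) - deriv Ωb x * (Ω1 x + deriv Ωb x)
        + (Ωb x / Ω2 x) ^ 2 * ((deriv Ω2 x) ^ 2 - Ω2 x * deriv (deriv Ω2) x))
  let b : ℝ → ℂ := fun x => 1 / (2 * (Ω2 x) ^ 2) *
      (Ω2 x * (Ω1 x + deriv Ωb x) - Ωb x * deriv Ω2 x)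
  have cdiv : ∀ {u v : ℝ → ℂ}, ContDiff ℝ 1 u → ContDiff ℝ 1 v → (∀ x, v x ≠ 0) →
      ContDiff ℝ 1 fun x => u x / v x := fun hu hv h => by
    simp only [div_eq_mul_inv]
    exact hu.mul (hv.inv h)
  have ha : ContDiff ℝ 1 a := by
    refine ContDiff.mul (cdiv contDiff_const ((contDiff_const.mul k2).mul kb)
      fun x => mul_ne_zero (mul_ne_zero two_ne_zero (h20 x)) (hb0 x)) ?_
    exact ((kb.mul (k1'.add hb2)).sub (kb'.mul (k1.add kb'))).add
      (((cdiv kb k2 h20).pow 2).mul ((k2'.pow 2).sub (k2.mul h22)))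
  have hb : ContDiff ℝ 1 b := by
    refine ContDiff.mul (cdiv contDiff_const (contDiff_const.mul (k2.pow 2))
      fun x => mul_ne_zero two_ne_zero (pow_ne_zero 2 (h20 x))) ?_
    exact (k2.mul (k1.add kb')).sub (kb.mul k2')
  have ca' : Continuous (deriv a) := ha.continuous_deriv le_rfl
  have cb' : Continuous (deriv b) := hb.continuous_deriv le_rfl
  let Υ0 : ℝ → ℂ := fun x => -2 * (Ω2 x) ^ 4 *
    (-((Ω2 x * deriv Ωb x - deriv Ω2 x * Ωb x) / (Ω2 x * Ωb x)) * Ω0 x * Ωb x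
      - (a x * Ω1 x + deriv a x * Ωb x) * Ωb x + (deriv Ω0 x * Ωb x - Ω0 x * deriv Ωb x))
  let Υ1 : ℝ → ℂ := fun x => -2 * (Ω2 x) ^ 4 *
    (2 * Ω0 x * Ωb x - (b x * Ω1 x + (a x + deriv b x) * Ωb x) * Ωb x)
  have hcontb := hΩb.continuous
  have hcont0 := hΩ0.continuous
  have hcont1 := hΩ1.continuous
  have hcont2 := hΩ2.continuous
  have hcontb' := hb1.continuous
  have hcont0' := h01.continuous
  have hcont2' := h21.continuous
  have hconta := ha.continuous
  have hcontB := hb.continuous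
  have hΥ0 : Continuous Υ0 := by
    have : Continuous fun x => (Ω2 x * deriv Ωb x - deriv Ω2 x * Ωb x) / (Ω2 x * Ωb x) :=
      Continuous.div (by fun_prop) (by fun_prop) hnz
    fun_prop
  have hΥ1 : Continuous Υ1 := by fun_prop
  refine ⟨Υ0, Υ1, fun f0 hf x => ?_, ?_⟩
  · have hf3 : ContDiff ℝ 3 f0 := contDiff_infty.1 hf 3
    have hf' : ContDiff ℝ 2 (deriv f0) := ContDiff.deriv' (n := 2) hf3
    have hf'' : ContDiff ℝ 1 (deriv (deriv f0)) := ContDiff.deriv' (n := 1) hf'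
    have dg : HasDerivAt (g0fun Ωb Ω1 Ω2 f0)
        (deriv f0 x * a x + f0 x * deriv a x + (deriv (deriv f0) x * b x + deriv f0 x * deriv b x)
          - ((deriv (deriv (deriv f0)) x * Ωb x + deriv (deriv f0) x * deriv Ωb x) * (2 * Ω2 x)
            - deriv (deriv f0) x * Ωb x * (2 * deriv Ω2 x)) / (2 * Ω2 x) ^ 2) x := by
      have hg : g0fun Ωb Ω1 Ω2 f0 = fun x => f0 x * a x + deriv f0 x * b x
          - deriv (deriv f0) x * Ωb x / (2 * Ω2 x) := by
        funext x
        simp only [g0fun, a, b]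
        ring
      rw [hg]
      have d {u : ℝ → ℂ} {n : WithTop ℕ∞} (hu : ContDiff ℝ n u) (hn : n ≠ 0) :
          HasDerivAt u (deriv u x) x := (hu.differentiable hn x).hasDerivAt
      exact (((d hf3 (by norm_num)).mul (d ha (by norm_num))).add
        ((d hf' (by norm_num)).mul (d hb (by norm_num)))).sub
        (((d hf'' (by norm_num)).mul (d kb (by norm_num))).div
          ((d k2 (by norm_num)).const_mul 2) (mul_ne_zero two_ne_zero (h20 x)))
    have hB : 2 * (Ω2 x) ^ 2 * b x = Ω2 x * (Ω1 x + deriv Ωb x) - Ωb x * deriv Ω2 x := by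
      have := h20 x
      simp only [b]
      field_simp
    have hg0 : g0fun Ωb Ω1 Ω2 f0 x = f0 x * a x + deriv f0 x * b x
          - deriv (deriv f0) x * Ωb x / (2 * Ω2 x) := by
      simp only [g0fun, a, b]
      ring
    have key : Υ0 x * f0 x + Υ1 x * deriv f0 x - (Ω2 x * Ωb x) ^ 3 * iteratedDeriv 3 f0 x =
        (-2 * (Ω2 x) ^ 4) * ((deriv f0 x - g1fun Ωb Ω2 f0 x) * Ω0 x * Ωb x
          - (g0fun Ωb Ω1 Ω2 f0 x * Ω1 x + deriv (g0fun Ωb Ω1 Ω2 f0) x * Ωb x) * Ωb x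
          + f0 x * (deriv Ω0 x * Ωb x - Ω0 x * deriv Ωb x)) := by
      rw [dg.deriv, hg0, iteratedDeriv_three]
      simp only [g1fun, Υ0, Υ1]
      have n2 := h20 x
      have nb := hb0 x
      generalize deriv a x = a', deriv b x = b', a x = ax at *
      generalize b x = bx at *
      have hbx : bx = (Ω2 x * (Ω1 x + deriv Ωb x) - Ωb x * deriv Ω2 x) / (2 * (Ω2 x) ^ 2) := by
        rw [← hB]
        field_simp
      rw [hbx]
      field_simp
      ring
    have hne : (-2 * (Ω2 x) ^ 4 : ℂ) ≠ 0 :=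
      mul_ne_zero (by norm_num) (pow_ne_zero 4 (h20 x))
    rw [key, mul_eq_zero, or_iff_right hne, thirdDetEq]
  · have hN : ∀ x, (Ω2 x * Ωb x) ^ 3 ≠ 0 := fun x => pow_ne_zero 3 (hnz x)
    have hcN : Continuous fun x => (Ω2 x * Ωb x) ^ 3 := by fun_prop
    have normal : ∀ (y : ℝ → ℂ) (x : ℝ), Υ0 x * y x + Υ1 x * deriv y x
          - (Ω2 x * Ωb x) ^ 3 * iteratedDeriv 3 y x = 0 ↔
        deriv (deriv (deriv y)) x = Υ0 x / (Ω2 x * Ωb x) ^ 3 * y x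
          + Υ1 x / (Ω2 x * Ωb x) ^ 3 * deriv y x := by
      intro y x
      rw [iteratedDeriv_three, div_mul_eq_mul_div, div_mul_eq_mul_div, ← add_div,
        eq_div_iff (hN x), sub_eq_zero, eq_comm, mul_comm]
    simp only [normal]
    exact exists_third_order_fundamental_system (hΥ0.div hcN hN) (hΥ1.div hcN hN)
end
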